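/- arXiv:1907.09949 — 4 statements merged into one kernel-verified Lean document; each statement's English description precedes it below -/
import Mathlib

section
/- For every τ ∈ ℕ, the map p ↦ V(τ,p) is a convex function on the interval [0,1]. (Lemma 1.) -/
open Finset

/-- The perspective of a convex function on `[0,1]` is subadditive. -/
theorem ConvexOn.perspective_add_le {f : ℝ → ℝ} (hf : ConvexOn ℝ (Set.Icc (0 : ℝ) 1) f)
    {n₁ d₁ n₂ d₂ : ℝ} (hn₁ : 0 ≤ n₁) (h₁ : n₁ ≤ d₁) (hn₂ : 0 ≤ n₂) (h₂ : n₂ ≤ d₂) :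
    (d₁ + d₂) * f ((n₁ + n₂) / (d₁ + d₂)) ≤ d₁ * f (n₁ / d₁) + d₂ * f (n₂ / d₂) := by
  rcases (hn₁.trans h₁).eq_or_lt with hd₁ | hd₁
  · obtain rfl : n₁ = 0 := by linarith
    simp [← hd₁]
  rcases (hn₂.trans h₂).eq_or_lt with hd₂ | hd₂
  · obtain rfl : n₂ = 0 := by linarith
    simp [← hd₂]
  have hd : 0 < d₁ + d₂ := add_pos hd₁ hd₂
  have hm₁ : n₁ / d₁ ∈ Set.Icc (0 : ℝ) 1 := ⟨by positivity, (div_le_one hd₁).2 h₁⟩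
  have hm₂ : n₂ / d₂ ∈ Set.Icc (0 : ℝ) 1 := ⟨by positivity, (div_le_one hd₂).2 h₂⟩
  have hw₁ : 0 ≤ d₁ / (d₁ + d₂) := by positivity
  have hw₂ : 0 ≤ d₂ / (d₁ + d₂) := by positivity
  have key := hf.2 hm₁ hm₂ hw₁ hw₂ (by field_simp)
  have harg : d₁ / (d₁ + d₂) * (n₁ / d₁) + d₂ / (d₁ + d₂) * (n₂ / d₂)
      = (n₁ + n₂) / (d₁ + d₂) := by field_simp
  simp only [smul_eq_mul, harg] at key
  calc (d₁ + d₂) * f ((n₁ + n₂) / (d₁ + d₂))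
      ≤ (d₁ + d₂) * (d₁ / (d₁ + d₂) * f (n₁ / d₁) + d₂ / (d₁ + d₂) * f (n₂ / d₂)) :=
        mul_le_mul_of_nonneg_left key hd.le
    _ = d₁ * f (n₁ / d₁) + d₂ * f (n₂ / d₂) := by field_simp

/-- Reweighting a convex function along a Bayesian belief update, with likelihoods `a` and `b`
and prior `p * g`, gives a convex function of `p`. -/
theorem ConvexOn.bayes_update {f : ℝ → ℝ} (hf : ConvexOn ℝ (Set.Icc (0 : ℝ) 1) f)
    {g a b : ℝ} (hg₀ : 0 ≤ g) (hg₁ : g ≤ 1) (ha : 0 ≤ a) (hb : 0 ≤ b) :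
    ConvexOn ℝ (Set.Icc (0 : ℝ) 1) fun p ↦
      (p * g * a + (1 - p * g) * b) * f ((p * g * a) / (p * g * a + (1 - p * g) * b)) := by
  refine ⟨convex_Icc 0 1, fun x hx y hy s t hs ht hst ↦ ?_⟩
  have hle : ∀ {z r : ℝ}, z ∈ Set.Icc (0 : ℝ) 1 → 0 ≤ r →
      0 ≤ r * (z * g * a) ∧ r * (z * g * a) ≤ r * (z * g * a + (1 - z * g) * b) := by
    intro z r hz hr
    have hzg : 0 ≤ 1 - z * g := sub_nonneg.2 (mul_le_one₀ hz.2 hg₀ hg₁)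
    have hz₀ := hz.1
    exact ⟨by positivity, mul_le_mul_of_nonneg_left
      (le_add_of_nonneg_right (mul_nonneg hzg hb)) hr⟩
  have hscale : ∀ r n d : ℝ, r * d * f (r * n / (r * d)) = r * (d * f (n / d)) := by
    intro r n d
    rcases eq_or_ne r 0 with rfl | hr
    · simp
    · rw [mul_div_mul_left _ _ hr, mul_assoc]
  have key := hf.perspective_add_le (hle hx hs).1 (hle hx hs).2 (hle hy ht).1 (hle hy ht).2
  rw [hscale, hscale] at key
  have hnum : (s * x + t * y) * g * a = s * (x * g * a) + t * (y * g * a) := by ring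
  have hden : s * (x * g * a) + t * (y * g * a) + (1 - (s * x + t * y) * g) * b
      = s * (x * g * a + (1 - x * g) * b) + t * (y * g * a + (1 - y * g) * b) := by
    linear_combination (-b) * hst
  simpa only [smul_eq_mul, hnum, hden] using key

/-- A finite sum of convex functions is convex. -/
theorem ConvexOn.finset_sum {ι : Type*} {s : Set ℝ} (hs : Convex ℝ s) (t : Finset ι)
    {f : ι → ℝ → ℝ} (hf : ∀ i ∈ t, ConvexOn ℝ s (f i)) :
    ConvexOn ℝ s fun x ↦ ∑ i ∈ t, f i x := by
  refine ⟨hs, fun x hx y hy a b ha hb hab ↦ ?_⟩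
  rw [Finset.smul_sum, Finset.smul_sum, ← Finset.sum_add_distrib]
  exact Finset.sum_le_sum fun i hi ↦ (hf i hi).2 hx hy ha hb hab

/-- **Lemma 1.** For the prediction-transmission POMDP value function `V` defined by the
backward recursion `V τ p = 0` for `τ > T` and `V τ p = max (E τ p) (A τ p)` for `τ ≤ T`,
the map `p ↦ V τ p` is convex on `[0,1]` for every `τ`. -/
theorem value_function_convex
    (L : ℕ) (hL : 2 ≤ L) (k : Fin L) (τs : ℕ) (hτs : 1 ≤ τs) (T : ℕ)
    (H C : Fin L → Fin L → ℝ)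
    (hH : ∀ i j, 0 ≤ H i j) (hC : ∀ i j, 0 ≤ C i j)
    (gE gA : ℕ → ℝ)
    (hgE : ∀ τ, 0 < gE τ ∧ gE τ ≤ 1) (hgA : ∀ τ, 0 < gA τ ∧ gA τ ≤ 1)
    (D : ℝ) (hD : 0 < D) (Y : Fin L → ℝ) (hY : ∀ j, 0 < Y j)
    (q : ℝ) (hq : q ∈ Set.Icc (0 : ℝ) 1)
    (V E A : ℕ → ℝ → ℝ)
    (hE : ∀ τ p, E τ p =
      ∑ j : Fin L, (p * gE τ * H j k + (1 - p * gE τ) * ∑ i : Fin L, C k i * H i j) *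
        V (τ + 1)
          ((p * gE τ * H j k) /
            (p * gE τ * H j k + (1 - p * gE τ) * ∑ i : Fin L, C k i * H i j)))
    (hA : ∀ τ p, A τ p =
      (p * gA τ + (1 - p * gA τ) * q) *
        V (τ + τs) ((p * gA τ) / (p * gA τ + (1 - p * gA τ) * q)) +
      (τs : ℝ) * (p * gA τ * D - (1 - p * gA τ) * ∑ j : Fin L, C k j * Y j))
    (hV0 : ∀ τ, T < τ → ∀ p : ℝ, V τ p = 0)
    (hVrec : ∀ τ, τ ≤ T → ∀ p : ℝ, V τ p = max (E τ p) (A τ p)) :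
    ∀ τ : ℕ, ConvexOn ℝ (Set.Icc (0 : ℝ) 1) (V τ) := by
  have step : ∀ n τ : ℕ, T < τ + n → ConvexOn ℝ (Set.Icc (0 : ℝ) 1) (V τ) := by
    intro n
    induction n with
    | zero =>
      intro τ hτ
      rw [show V τ = fun _ ↦ 0 from funext (hV0 τ hτ)]
      exact convexOn_const 0 (convex_Icc 0 1)
    | succ n ih =>
      intro τ hτ
      rcases lt_or_ge T τ with h | h
      · rw [show V τ = fun _ ↦ 0 from funext (hV0 τ h)]
        exact convexOn_const 0 (convex_Icc 0 1)
      have hEconv : ConvexOn ℝ (Set.Icc (0 : ℝ) 1) (E τ) := by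
        rw [show E τ = _ from funext (hE τ)]
        refine ConvexOn.finset_sum (convex_Icc 0 1) _ fun j _ ↦ ?_
        exact (ih (τ + 1) (by omega)).bayes_update (hgE τ).1.le (hgE τ).2 (hH j k)
          (Finset.sum_nonneg fun i _ ↦ mul_nonneg (hC k i) (hH i j))
      have hAconv : ConvexOn ℝ (Set.Icc (0 : ℝ) 1) (A τ) := by
        rw [show A τ = _ from funext (hA τ)]
        refine ConvexOn.add ?_ ⟨convex_Icc 0 1, fun x _ y _ s t _ _ hst ↦ le_of_eq ?_⟩
        · simpa only [mul_one] using (ih (τ + τs) (by omega)).bayes_update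
            (hgA τ).1.le (hgA τ).2 zero_le_one hq.1
        · simp only [smul_eq_mul]
          linear_combination (τs * ∑ j : Fin L, C k j * Y j) * hst
      rw [show V τ = E τ ⊔ A τ from funext (hVrec τ h)]
      exact hEconv.sup hAconv
  exact fun τ ↦ step (T + 1) τ (by omega)
end

section
/- For every τ ∈ ℕ, the map p ↦ V(τ,p) is nondecreasing on the interval [0,1]. (Lemma 2.) -/
open Finset

/-- The Bayesian posterior belief lies in the unit interval. -/
theorem posterior_mem_Icc {a b : ℝ} (ha : 0 ≤ a) (hb : 0 ≤ b) :
    a / (a + b) ∈ Set.Icc (0 : ℝ) 1 :=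
  ⟨by positivity, div_le_one_of_le₀ (by linarith) (by linarith)⟩

/-- A convex function satisfies the subadditivity inequality for its perspective. -/
theorem ConvexOn.perspective_le {v : ℝ → ℝ} (hv : ConvexOn ℝ (Set.Icc 0 1) v)
    {a₁ b₁ a₂ b₂ s t : ℝ} (ha₁ : 0 ≤ a₁) (hb₁ : 0 ≤ b₁) (ha₂ : 0 ≤ a₂) (hb₂ : 0 ≤ b₂)
    (hs : 0 ≤ s) (ht : 0 ≤ t) :
    (s * (a₁ + b₁) + t * (a₂ + b₂)) *
        v ((s * a₁ + t * a₂) / (s * (a₁ + b₁) + t * (a₂ + b₂))) ≤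
      s * ((a₁ + b₁) * v (a₁ / (a₁ + b₁))) + t * ((a₂ + b₂) * v (a₂ / (a₂ + b₂))) := by
  have h₁ : 0 ≤ s * (a₁ + b₁) := by positivity
  have h₂ : 0 ≤ t * (a₂ + b₂) := by positivity
  have e₁ : (a₁ + b₁) * (a₁ / (a₁ + b₁)) = a₁ :=
    mul_div_cancel_of_imp' fun h => by linarith
  have e₂ : (a₂ + b₂) * (a₂ / (a₂ + b₂)) = a₂ :=
    mul_div_cancel_of_imp' fun h => by linarith
  rw [← mul_assoc, ← mul_assoc]
  rcases (add_nonneg h₁ h₂).eq_or_lt with hw | hw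
  · have z₁ : s * (a₁ + b₁) = 0 := by linarith
    have z₂ : t * (a₂ + b₂) = 0 := by linarith
    simp [z₁, z₂]
  · set w := s * (a₁ + b₁) + t * (a₂ + b₂) with hwdef
    have key := hv.2 (posterior_mem_Icc ha₁ hb₁) (posterior_mem_Icc ha₂ hb₂)
      (div_nonneg h₁ hw.le) (div_nonneg h₂ hw.le) (by rw [← add_div, ← hwdef, div_self hw.ne'])
    simp only [smul_eq_mul] at key
    have harg : s * (a₁ + b₁) / w * (a₁ / (a₁ + b₁)) + t * (a₂ + b₂) / w * (a₂ / (a₂ + b₂))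
        = (s * a₁ + t * a₂) / w := by
      rw [div_mul_eq_mul_div, div_mul_eq_mul_div, mul_assoc, mul_assoc, e₁, e₂, add_div]
    rw [harg] at key
    refine (mul_le_mul_of_nonneg_left key hw.le).trans_eq ?_
    field_simp

/-- The expected continuation value after a Bayesian update is convex in the prior belief. -/
theorem ConvexOn.bayes_update_s2 {v : ℝ → ℝ} (hv : ConvexOn ℝ (Set.Icc 0 1) v)
    {g x c : ℝ} (hg : 0 ≤ g) (hg1 : g ≤ 1) (hx : 0 ≤ x) (hc : 0 ≤ c) :
    ConvexOn ℝ (Set.Icc 0 1) fun p =>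
      (p * g * x + (1 - p * g) * c) * v (p * g * x / (p * g * x + (1 - p * g) * c)) := by
  refine ⟨convex_Icc 0 1, fun p hp r hr s t hs ht hst => ?_⟩
  have hb : ∀ p ∈ Set.Icc (0 : ℝ) 1, 0 ≤ (1 - p * g) * c := fun p hp =>
    mul_nonneg (sub_nonneg.2 (mul_le_one₀ hp.2 hg hg1)) hc
  have key := hv.perspective_le (mul_nonneg (mul_nonneg hp.1 hg) hx) (hb p hp)
    (mul_nonneg (mul_nonneg hr.1 hg) hx) (hb r hr) hs ht
  have hnum : (s * p + t * r) * g * x = s * (p * g * x) + t * (r * g * x) := by ring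
  have hden : s * (p * g * x) + t * (r * g * x) + (1 - (s * p + t * r) * g) * c =
      s * (p * g * x + (1 - p * g) * c) + t * (r * g * x + (1 - r * g) * c) := by
    linear_combination -c * hst
  simpa only [smul_eq_mul, hnum, hden] using key

/-- The expected continuation value is nonnegative if the value function is. -/
theorem bayes_update_nonneg {v : ℝ → ℝ} (hv : ∀ p ∈ Set.Icc (0 : ℝ) 1, 0 ≤ v p)
    {g x c p : ℝ} (hg : 0 ≤ g) (hg1 : g ≤ 1) (hx : 0 ≤ x) (hc : 0 ≤ c)
    (hp : p ∈ Set.Icc (0 : ℝ) 1) :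
    0 ≤ (p * g * x + (1 - p * g) * c) * v (p * g * x / (p * g * x + (1 - p * g) * c)) := by
  have ha : 0 ≤ p * g * x := mul_nonneg (mul_nonneg hp.1 hg) hx
  have hb : 0 ≤ (1 - p * g) * c := mul_nonneg (sub_nonneg.2 (mul_le_one₀ hp.2 hg hg1)) hc
  exact mul_nonneg (add_nonneg ha hb) (hv _ (posterior_mem_Icc ha hb))

/-- A convex function on the unit interval that is minimal at `0` is monotone there. -/
theorem ConvexOn.monotoneOn_of_zero_le {v : ℝ → ℝ} (hv : ConvexOn ℝ (Set.Icc 0 1) v)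
    (hmin : ∀ p ∈ Set.Icc (0 : ℝ) 1, v 0 ≤ v p) : MonotoneOn v (Set.Icc 0 1) := by
  intro p hp r hr hpr
  rcases hp.1.eq_or_lt with rfl | hp0
  · exact hmin r hr
  have hr0 : 0 < r := hp0.trans_le hpr
  have key := hv.2 (Set.left_mem_Icc.2 zero_le_one) hr
    (sub_nonneg.2 (div_le_one_of_le₀ hpr hr0.le)) (div_nonneg hp.1 hr.1) (sub_add_cancel 1 (p / r))
  simp only [smul_eq_mul, mul_zero, zero_add, div_mul_cancel₀ p hr0.ne'] at key
  nlinarith [hmin r hr, div_le_one_of_le₀ hpr hr0.le]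

theorem value_function_monotone
    (L : ℕ) (hL : 2 ≤ L) (k : Fin L) (τs : ℕ) (hτs : 1 ≤ τs) (T : ℕ)
    (H C : Fin L → Fin L → ℝ)
    (hH : ∀ i j, 0 ≤ H i j) (hC : ∀ i j, 0 ≤ C i j)
    (gE gA : ℕ → ℝ)
    (hgE : ∀ τ, 0 < gE τ ∧ gE τ ≤ 1) (hgA : ∀ τ, 0 < gA τ ∧ gA τ ≤ 1)
    (D : ℝ) (hD : 0 < D) (Y : Fin L → ℝ) (hY : ∀ j, 0 < Y j)
    (q : ℝ) (hq : q ∈ Set.Icc (0 : ℝ) 1)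
    (V E A : ℕ → ℝ → ℝ)
    (hE : ∀ τ p, E τ p =
      ∑ j : Fin L, (p * gE τ * H j k + (1 - p * gE τ) * ∑ i : Fin L, C k i * H i j) *
        V (τ + 1)
          ((p * gE τ * H j k) /
            (p * gE τ * H j k + (1 - p * gE τ) * ∑ i : Fin L, C k i * H i j)))
    (hA : ∀ τ p, A τ p =
      (p * gA τ + (1 - p * gA τ) * q) *
        V (τ + τs) ((p * gA τ) / (p * gA τ + (1 - p * gA τ) * q)) +
      (τs : ℝ) * (p * gA τ * D - (1 - p * gA τ) * ∑ j : Fin L, C k j * Y j))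
    (hV0 : ∀ τ, T < τ → ∀ p : ℝ, V τ p = 0)
    (hVrec : ∀ τ, τ ≤ T → ∀ p : ℝ, V τ p = max (E τ p) (A τ p))
    (hHrow : ∀ i, ∑ j : Fin L, H i j = 1) (hHcol : ∀ j, ∑ i : Fin L, H i j = 1)
    (hCrow : ∑ j : Fin L, C k j = 1) (hCkk : C k k = 0)
    (hMis1 : ∀ j, j ≠ k → H j k < ∑ i : Fin L, C k i * H i j)
    (hMis2 : ∀ j, j ≠ k → H j k * (∑ i : Fin L, C k i * H i k)
      < H k k * (∑ i : Fin L, C k i * H i j)) :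
    ∀ τ : ℕ, MonotoneOn (V τ) (Set.Icc (0 : ℝ) 1) := by
  have hc : ∀ j, 0 ≤ ∑ i, C k i * H i j := fun j =>
    sum_nonneg fun i _ => mul_nonneg (hC k i) (hH i j)
  have hCY : 0 ≤ ∑ j, C k j * Y j := sum_nonneg fun j _ => mul_nonneg (hC k j) (hY j).le
  have key : ∀ n τ, T + 1 ≤ τ + n → ConvexOn ℝ (Set.Icc 0 1) (V τ) ∧
      (∀ p ∈ Set.Icc (0 : ℝ) 1, 0 ≤ V τ p) ∧ V τ 0 = 0 := by
    intro n
    induction n with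
    | zero =>
      intro τ hτ
      have hzero : V τ = fun _ => 0 := funext (hV0 τ (by lia))
      rw [hzero]
      exact ⟨convexOn_const 0 (convex_Icc 0 1), fun _ _ => le_rfl, rfl⟩
    | succ n ih =>
      intro τ hτ
      rcases lt_or_ge T τ with hT | hT
      · exact ih τ (by lia)
      obtain ⟨cE, nE, zE⟩ := ih (τ + 1) (by lia)
      obtain ⟨cA, -, zA⟩ := ih (τ + τs) (by lia)
      refine ⟨?_, fun p hp => ?_, ?_⟩
      · have hVmax : V τ = E τ ⊔ A τ := funext (hVrec τ hT)
        rw [hVmax]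
        refine ConvexOn.sup ?_ ?_
        · rw [funext (hE τ)]
          refine ⟨convex_Icc 0 1, fun p hp r hr s t hs ht hst => ?_⟩
          rw [smul_sum, smul_sum, ← sum_add_distrib]
          exact sum_le_sum fun j _ =>
            (cE.bayes_update_s2 (hgE τ).1.le (hgE τ).2 (hH j k) (hc j)).2 hp hr hs ht hst
        · rw [funext (hA τ)]
          refine ConvexOn.add ?_ ?_
          · simpa only [mul_one] using
              cA.bayes_update_s2 (hgA τ).1.le (hgA τ).2 zero_le_one hq.1
          · refine ⟨convex_Icc 0 1, fun p _ r _ s t _ _ hst => le_of_eq ?_⟩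
            simp only [smul_eq_mul]
            linear_combination (τs : ℝ) * (∑ j, C k j * Y j) * hst
      · rw [hVrec τ hT, hE]
        exact le_max_of_le_left <| sum_nonneg fun j _ =>
          bayes_update_nonneg nE (hgE τ).1.le (hgE τ).2 (hH j k) (hc j) hp
      · rw [hVrec τ hT, hE, hA]
        simp only [zero_mul, zero_div, zE, zA, mul_zero, sum_const_zero, sub_zero, one_mul,
          zero_add, zero_sub, max_eq_left_iff]
        exact mul_nonpos_of_nonneg_of_nonpos τs.cast_nonneg (neg_nonpos.2 hCY)
  intro τ
  obtain ⟨hconv, hnonneg, hzero⟩ := key (T + 1) τ (by lia)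
  exact hconv.monotoneOn_of_zero_le fun p hp => hzero.le.trans (hnonneg p hp)
end

section
/- For every τ ≤ 𝒯, the sensing utility p ↦ E(τ,p) is a convex and nondecreasing function on the interval [0,1]. (First half of Lemma 3.) -/
open Finset

/-- The probability of an observation whose likelihood is `α` under the hypothesis, which has prior
probability `x`, and `β` otherwise. -/
noncomputable abbrev mixWeight (α β x : ℝ) : ℝ := x * α + (1 - x) * β

/-- The posterior probability of the hypothesis after that observation. -/
noncomputable abbrev posterior (α β x : ℝ) : ℝ := (x * α) / mixWeight α β x

theorem mixWeight_nonneg {α β x : ℝ} (hα : 0 ≤ α) (hβ : 0 ≤ β) (hx : x ∈ Set.Icc (0 : ℝ) 1) :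
    0 ≤ mixWeight α β x :=
  add_nonneg (mul_nonneg hx.1 hα) (mul_nonneg (sub_nonneg.2 hx.2) hβ)

theorem posterior_mem_Icc_s3 {α β x : ℝ} (hα : 0 ≤ α) (hβ : 0 ≤ β) (hx : x ∈ Set.Icc (0 : ℝ) 1) :
    posterior α β x ∈ Set.Icc (0 : ℝ) 1 :=
  ⟨div_nonneg (mul_nonneg hx.1 hα) (mixWeight_nonneg hα hβ hx),
    div_le_one_of_le₀ (le_add_of_nonneg_right (mul_nonneg (sub_nonneg.2 hx.2) hβ))
      (mixWeight_nonneg hα hβ hx)⟩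

theorem mixWeight_mul_posterior {α β x : ℝ} (hα : 0 ≤ α) (hβ : 0 ≤ β)
    (hx : x ∈ Set.Icc (0 : ℝ) 1) : mixWeight α β x * posterior α β x = x * α := by
  refine mul_div_cancel_of_imp' fun h => ?_
  have h₁ := mul_nonneg hx.1 hα
  have h₂ := mul_nonneg (sub_nonneg.2 hx.2) hβ
  simp only [mixWeight] at h
  linarith

theorem posterior_le_posterior {α β x y : ℝ} (hα : 0 ≤ α) (hβ : 0 ≤ β)
    (hx : x ∈ Set.Icc (0 : ℝ) 1) (hy : y ∈ Set.Icc (0 : ℝ) 1) (hxy : x ≤ y)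
    (hw : 0 < mixWeight α β y) : posterior α β x ≤ posterior α β y := by
  rcases (mixWeight_nonneg hα hβ hx).eq_or_lt with h | h
  · rw [posterior, ← h, div_zero]
    exact (posterior_mem_Icc_s3 hα hβ hy).1
  · rw [posterior, posterior, div_le_div_iff₀ h hw]
    simp only [mixWeight]
    nlinarith [mul_nonneg (mul_nonneg hα hβ) (sub_nonneg.2 hxy)]

/-- A larger likelihood ratio gives a larger posterior. -/
theorem posterior_le_posterior_of_ratio {α β α' β' x : ℝ} (hα : 0 ≤ α) (hβ : 0 ≤ β)
    (hα' : 0 < α') (hβ' : 0 ≤ β') (hx : x ∈ Set.Icc (0 : ℝ) 1) (h : α * β' ≤ α' * β) :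
    posterior α β x ≤ posterior α' β' x := by
  rcases hx.1.eq_or_lt with rfl | hx0
  · simp [posterior]
  have hw' : 0 < mixWeight α' β' x :=
    add_pos_of_pos_of_nonneg (mul_pos hx0 hα') (mul_nonneg (sub_nonneg.2 hx.2) hβ')
  rcases (mixWeight_nonneg hα hβ hx).eq_or_lt with hw | hw
  · rw [posterior, ← hw, div_zero]
    exact (posterior_mem_Icc_s3 hα'.le hβ' hx).1
  · rw [posterior, posterior, div_le_div_iff₀ hw hw']
    simp only [mixWeight]
    nlinarith [mul_le_mul_of_nonneg_left h (mul_nonneg hx.1 (sub_nonneg.2 hx.2))]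

/-- The perspective of a convex function along a Bayesian update is convex in the prior. -/
theorem ConvexOn.mixWeight_mul_comp_posterior {f : ℝ → ℝ}
    (hf : ConvexOn ℝ (Set.Icc (0 : ℝ) 1) f) {α β : ℝ} (hα : 0 ≤ α) (hβ : 0 ≤ β) :
    ConvexOn ℝ (Set.Icc (0 : ℝ) 1) fun x => mixWeight α β x * f (posterior α β x) := by
  refine ⟨convex_Icc 0 1, fun x hx y hy s t hs ht hst => ?_⟩
  have hz : s • x + t • y ∈ Set.Icc (0 : ℝ) 1 := convex_Icc 0 1 hx hy hs ht hst
  simp only [smul_eq_mul] at hz ⊢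
  have hu := mul_nonneg hs (mixWeight_nonneg hα hβ hx)
  have hv := mul_nonneg ht (mixWeight_nonneg hα hβ hy)
  have hw : mixWeight α β (s * x + t * y) = s * mixWeight α β x + t * mixWeight α β y := by
    simp only [mixWeight]
    linear_combination -β * hst
  have hp := mixWeight_mul_posterior hα hβ hz
  have hpx := mixWeight_mul_posterior hα hβ hx
  have hpy := mixWeight_mul_posterior hα hβ hy
  rcases (mixWeight_nonneg hα hβ hz).eq_or_lt with h0 | hpos
  · have hu0 : s * mixWeight α β x = 0 := by linarith
    have hv0 : t * mixWeight α β y = 0 := by linarith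
    rw [← h0, ← mul_assoc, ← mul_assoc, hu0, hv0]
    simp
  · generalize mixWeight α β (s * x + t * y) = w at *
    have key := hf.2 (posterior_mem_Icc_s3 hα hβ hx) (posterior_mem_Icc_s3 hα hβ hy)
      (div_nonneg hu hpos.le) (div_nonneg hv hpos.le)
      (by rw [← add_div, ← hw, div_self hpos.ne'])
    have hpt : (s * mixWeight α β x / w) • posterior α β x
        + (t * mixWeight α β y / w) • posterior α β y = posterior α β (s * x + t * y) := by
      apply mul_left_cancel₀ hpos.ne'
      rw [hp, smul_eq_mul, smul_eq_mul]
      field_simp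
      linear_combination s * hpx + t * hpy
    rw [hpt] at key
    calc _ ≤ w * ((s * mixWeight α β x / w) • f (posterior α β x)
          + (t * mixWeight α β y / w) • f (posterior α β y)) :=
          mul_le_mul_of_nonneg_left key hpos.le
      _ = _ := by
          rw [smul_eq_mul, smul_eq_mul]
          field_simp

/-- Rescaling the argument by a factor in `[0, 1]` preserves convexity on `[0, 1]`. -/
theorem ConvexOn.comp_mul_right_Icc {f : ℝ → ℝ} (hf : ConvexOn ℝ (Set.Icc (0 : ℝ) 1) f) {g : ℝ}
    (hg : g ∈ Set.Icc (0 : ℝ) 1) : ConvexOn ℝ (Set.Icc (0 : ℝ) 1) fun p => f (p * g) := by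
  refine (hf.comp_linearMap (LinearMap.mulRight ℝ g)).subset (fun p hp => ?_) (convex_Icc 0 1)
  exact unitInterval.mul_mem hp hg

/-- The expected value of `f` at the posterior is monotone in the prior, provided one of the
observations `k` is the only one favouring the hypothesis and has the largest likelihood ratio. -/
theorem MonotoneOn.sum_mixWeight_mul_comp_posterior {ι : Type*} [Fintype ι] {f : ℝ → ℝ}
    (hf : MonotoneOn f (Set.Icc (0 : ℝ) 1)) {α β : ι → ℝ} (hα : ∀ j, 0 ≤ α j)
    (hβ : ∀ j, 0 ≤ β j) (hsum : ∑ j, α j = ∑ j, β j) {k : ι} (hk : 0 < α k)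
    (hle : ∀ j, j ≠ k → α j ≤ β j) (hratio : ∀ j, j ≠ k → α j * β k ≤ α k * β j) :
    MonotoneOn (fun x => ∑ j, mixWeight (α j) (β j) x * f (posterior (α j) (β j) x))
      (Set.Icc (0 : ℝ) 1) := by
  intro x hx y hy hxy
  have hterm : ∀ j, mixWeight (α j) (β j) x * f (posterior (α j) (β j) x)
      + (y - x) * (α j - β j) * f (posterior (α k) (β k) x)
      ≤ mixWeight (α j) (β j) y * f (posterior (α j) (β j) y) := by
    intro j
    have hstep : mixWeight (α j) (β j) y * f (posterior (α j) (β j) x)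
        ≤ mixWeight (α j) (β j) y * f (posterior (α j) (β j) y) := by
      rcases (mixWeight_nonneg (hα j) (hβ j) hy).eq_or_lt with h | h
      · simp [← h]
      · exact mul_le_mul_of_nonneg_left (hf (posterior_mem_Icc_s3 (hα j) (hβ j) hx)
          (posterior_mem_Icc_s3 (hα j) (hβ j) hy)
          (posterior_le_posterior (hα j) (hβ j) hx hy hxy h)) h.le
    have hw : mixWeight (α j) (β j) y
        = mixWeight (α j) (β j) x + (y - x) * (α j - β j) := by
      simp only [mixWeight]
      ring
    refine le_trans ?_ hstep
    rw [hw, add_mul (mixWeight (α j) (β j) x)]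
    by_cases hj : j = k
    · rw [hj]
    · have hfk := hf (posterior_mem_Icc_s3 (hα j) (hβ j) hx) (posterior_mem_Icc_s3 (hα k) (hβ k) hx)
        (posterior_le_posterior_of_ratio (hα j) (hβ j) hk (hβ k) hx (hratio j hj))
      exact add_le_add_right (mul_le_mul_of_nonpos_left hfk
        (mul_nonpos_of_nonneg_of_nonpos (sub_nonneg.2 hxy) (sub_nonpos.2 (hle j hj)))) _
  have h := Finset.sum_le_sum fun j (_ : j ∈ univ) => hterm j
  rwa [sum_add_distrib, ← sum_mul, ← mul_sum, sum_sub_distrib, hsum, sub_self, mul_zero, zero_mul,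
    add_zero] at h

theorem sensing_utility_convex_monotone
    (L : ℕ) (hL : 2 ≤ L) (k : Fin L) (τs : ℕ) (hτs : 1 ≤ τs) (T : ℕ)
    (H C : Fin L → Fin L → ℝ)
    (hH : ∀ i j, 0 ≤ H i j) (hC : ∀ i j, 0 ≤ C i j)
    (gE gA : ℕ → ℝ)
    (hgE : ∀ τ, 0 < gE τ ∧ gE τ ≤ 1) (hgA : ∀ τ, 0 < gA τ ∧ gA τ ≤ 1)
    (D : ℝ) (hD : 0 < D) (Y : Fin L → ℝ) (hY : ∀ j, 0 < Y j)
    (q : ℝ) (hq : q ∈ Set.Icc (0 : ℝ) 1)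
    (V E A : ℕ → ℝ → ℝ)
    (hE : ∀ τ p, E τ p =
      ∑ j : Fin L, (p * gE τ * H j k + (1 - p * gE τ) * ∑ i : Fin L, C k i * H i j) *
        V (τ + 1)
          ((p * gE τ * H j k) /
            (p * gE τ * H j k + (1 - p * gE τ) * ∑ i : Fin L, C k i * H i j)))
    (hA : ∀ τ p, A τ p =
      (p * gA τ + (1 - p * gA τ) * q) *
        V (τ + τs) ((p * gA τ) / (p * gA τ + (1 - p * gA τ) * q)) +
      (τs : ℝ) * (p * gA τ * D - (1 - p * gA τ) * ∑ j : Fin L, C k j * Y j))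
    (hV0 : ∀ τ, T < τ → ∀ p : ℝ, V τ p = 0)
    (hVrec : ∀ τ, τ ≤ T → ∀ p : ℝ, V τ p = max (E τ p) (A τ p))
    (hHrow : ∀ i, ∑ j : Fin L, H i j = 1) (hHcol : ∀ j, ∑ i : Fin L, H i j = 1)
    (hCrow : ∑ j : Fin L, C k j = 1) (hCkk : C k k = 0)
    (hMis1 : ∀ j, j ≠ k → H j k < ∑ i : Fin L, C k i * H i j)
    (hMis2 : ∀ j, j ≠ k → H j k * (∑ i : Fin L, C k i * H i k)
      < H k k * (∑ i : Fin L, C k i * H i j)) :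
    ∀ τ, τ ≤ T →
      ConvexOn ℝ (Set.Icc (0 : ℝ) 1) (E τ) ∧ MonotoneOn (E τ) (Set.Icc (0 : ℝ) 1) := by
  set c : Fin L → ℝ := fun j => ∑ i : Fin L, C k i * H i j with hc
  have hc0 : ∀ j, 0 ≤ c j := fun j => sum_nonneg fun i _ => mul_nonneg (hC k i) (hH i j)
  have hsum : ∑ j, H j k = ∑ j, c j := by
    simp only [hc]
    rw [sum_comm, hHcol k]
    simp only [← mul_sum, hHrow, mul_one, hCrow]
  have hkk : 0 < H k k := by
    have : Nontrivial (Fin L) := Fin.nontrivial_iff_two_le.2 hL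
    obtain ⟨j, hj⟩ := exists_ne k
    exact pos_of_mul_pos_left
      ((mul_nonneg (hH j k) (hc0 k)).trans_lt (hMis2 j hj)) (hc0 j)
  have hgE' : ∀ τ, gE τ ∈ Set.Icc (0 : ℝ) 1 := fun τ => ⟨(hgE τ).1.le, (hgE τ).2⟩
  have hgA' : ∀ τ, gA τ ∈ Set.Icc (0 : ℝ) 1 := fun τ => ⟨(hgA τ).1.le, (hgA τ).2⟩
  have hEeq : ∀ τ, E τ = fun p => ∑ j, mixWeight (H j k) (c j) (p * gE τ) *
      V (τ + 1) (posterior (H j k) (c j) (p * gE τ)) := fun τ => funext (hE τ)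
  have hAeq : ∀ τ, A τ = fun p => mixWeight 1 q (p * gA τ) *
      V (τ + τs) (posterior 1 q (p * gA τ)) +
      (τs : ℝ) * (p * gA τ * D - (1 - p * gA τ) * ∑ j, C k j * Y j) := fun τ => by
    funext p
    simp only [hA, mixWeight, posterior, mul_one]
  have hEconv : ∀ τ, ConvexOn ℝ (Set.Icc (0 : ℝ) 1) (V (τ + 1)) →
      ConvexOn ℝ (Set.Icc (0 : ℝ) 1) (E τ) := by
    intro τ hV
    rw [hEeq]
    refine ⟨convex_Icc 0 1, fun x hx y hy s t hs ht hst => ?_⟩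
    simp only [smul_sum, ← sum_add_distrib]
    exact sum_le_sum fun j _ => ((hV.mixWeight_mul_comp_posterior (hH j k)
      (hc0 j)).comp_mul_right_Icc (hgE' τ)).2 hx hy hs ht hst
  have hEmono : ∀ τ, MonotoneOn (V (τ + 1)) (Set.Icc (0 : ℝ) 1) →
      MonotoneOn (E τ) (Set.Icc (0 : ℝ) 1) := by
    intro τ hV x hx y hy hxy
    rw [hEeq]
    exact hV.sum_mixWeight_mul_comp_posterior (fun j => hH j k) hc0 hsum hkk
      (fun j hj => (hMis1 j hj).le) (fun j hj => (hMis2 j hj).le)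
      (unitInterval.mul_mem hx (hgE' τ)) (unitInterval.mul_mem hy (hgE' τ))
      (mul_le_mul_of_nonneg_right hxy (hgE' τ).1)
  have hEnonneg : ∀ τ, (∀ p ∈ Set.Icc (0 : ℝ) 1, 0 ≤ V (τ + 1) p) →
      ∀ p ∈ Set.Icc (0 : ℝ) 1, 0 ≤ E τ p := by
    intro τ hV p hp
    have hx := unitInterval.mul_mem hp (hgE' τ)
    rw [hEeq]
    exact sum_nonneg fun j _ => mul_nonneg (mixWeight_nonneg (hH j k) (hc0 j) hx)
      (hV _ (posterior_mem_Icc_s3 (hH j k) (hc0 j) hx))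
  have hAconv : ∀ τ, ConvexOn ℝ (Set.Icc (0 : ℝ) 1) (V (τ + τs)) →
      ConvexOn ℝ (Set.Icc (0 : ℝ) 1) (A τ) := by
    intro τ hV
    rw [hAeq]
    refine ((hV.mixWeight_mul_comp_posterior zero_le_one hq.1).comp_mul_right_Icc (hgA' τ)).add
      ⟨convex_Icc 0 1, fun x _ y _ s t _ _ hst => le_of_eq ?_⟩
    simp only [smul_eq_mul]
    linear_combination (τs : ℝ) * (∑ j, C k j * Y j) * hst
  have hAmono : ∀ τ, MonotoneOn (V (τ + τs)) (Set.Icc (0 : ℝ) 1) →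
      (∀ p ∈ Set.Icc (0 : ℝ) 1, 0 ≤ V (τ + τs) p) → MonotoneOn (A τ) (Set.Icc (0 : ℝ) 1) := by
    intro τ hV hV0 p hp p' hp' hpp'
    have hx := unitInterval.mul_mem hp (hgA' τ)
    have hy := unitInterval.mul_mem hp' (hgA' τ)
    have hxy : p * gA τ ≤ p' * gA τ := mul_le_mul_of_nonneg_right hpp' (hgA' τ).1
    have hS : 0 ≤ ∑ j, C k j * Y j := sum_nonneg fun j _ => mul_nonneg (hC k j) (hY j).le
    simp only [hAeq]
    generalize p * gA τ = x at *
    generalize p' * gA τ = y at *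
    have hw : mixWeight 1 q x ≤ mixWeight 1 q y := by
      simp only [mixWeight]
      nlinarith [mul_nonneg (sub_nonneg.2 hxy) (sub_nonneg.2 hq.2)]
    have hxm := posterior_mem_Icc_s3 zero_le_one hq.1 hx
    have hym := posterior_mem_Icc_s3 zero_le_one hq.1 hy
    refine add_le_add ?_ (mul_le_mul_of_nonneg_left ?_ (Nat.cast_nonneg _))
    · rcases (mixWeight_nonneg zero_le_one hq.1 hy).eq_or_lt with h | h
      · rw [← h, le_antisymm (hw.trans_eq h.symm) (mixWeight_nonneg zero_le_one hq.1 hx),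
          zero_mul, zero_mul]
      · exact mul_le_mul hw
          (hV hxm hym (posterior_le_posterior zero_le_one hq.1 hx hy hxy h))
          (hV0 _ hxm) h.le
    · nlinarith [mul_le_mul_of_nonneg_right hxy hD.le, mul_le_mul_of_nonneg_right hxy hS]
  have hVprop : ∀ n τ, T < τ + n → ConvexOn ℝ (Set.Icc (0 : ℝ) 1) (V τ) ∧
      MonotoneOn (V τ) (Set.Icc (0 : ℝ) 1) ∧ ∀ p ∈ Set.Icc (0 : ℝ) 1, 0 ≤ V τ p := by
    intro n
    induction n with
    | zero =>
      intro τ hτ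
      rw [show V τ = fun _ => 0 from funext (hV0 τ hτ)]
      exact ⟨convexOn_const 0 (convex_Icc 0 1), monotoneOn_const, fun _ _ => le_rfl⟩
    | succ n ih =>
      intro τ hτ
      rcases lt_or_ge T (τ + n) with h | h
      · exact ih τ h
      obtain ⟨hc₁, hm₁, hn₁⟩ := ih (τ + 1) (by omega)
      obtain ⟨hc₂, hm₂, hn₂⟩ := ih (τ + τs) (by omega)
      have hVτ := hVrec τ (by omega)
      refine ⟨?_, ?_, fun p hp => ?_⟩
      · rw [show V τ = E τ ⊔ A τ from funext hVτ]
        exact (hEconv τ hc₁).sup (hAconv τ hc₂)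
      · rw [show V τ = E τ ⊔ A τ from funext hVτ]
        exact (hEmono τ hm₁).sup (hAmono τ hm₂ hn₂)
      · rw [hVτ]
        exact (hEnonneg τ hn₁ p hp).trans (le_max_left _ _)
  intro τ _
  obtain ⟨hconv, hmono, -⟩ := hVprop (T + 1) (τ + 1) (by omega)
  exact ⟨hEconv τ hconv, hEmono τ hmono⟩
end

section
/- For every τ ≤ 𝒯, the transmission utility p ↦ A(τ,p) is a convex and strictly increasing function on the interval [0,1]. (Second half of Lemma 3.) -/
open Finset

/-- A convex function on `[0,1]` that attains its minimum value `0` at the origin. -/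
structure ConvexMinAtZero (f : ℝ → ℝ) : Prop where
  convexOn : ConvexOn ℝ (Set.Icc (0 : ℝ) 1) f
  map_zero : f 0 = 0
  nonneg : ∀ p ∈ Set.Icc (0 : ℝ) 1, 0 ≤ f p

theorem ConvexMinAtZero.monotoneOn {f : ℝ → ℝ} (hf : ConvexMinAtZero f) :
    MonotoneOn f (Set.Icc (0 : ℝ) 1) := by
  intro x hx y hy hxy
  rcases hx.1.eq_or_lt with h0 | h0
  · rw [← h0, hf.map_zero]
    exact hf.nonneg y hy
  have hy0 : 0 < y := h0.trans_le hxy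
  have hle : x / y ≤ 1 := (div_le_one hy0).2 hxy
  have h := hf.convexOn.2 (Set.left_mem_Icc.2 zero_le_one) hy
    (sub_nonneg.2 hle) (div_nonneg hx.1 hy0.le) (sub_add_cancel 1 (x / y))
  simp only [smul_eq_mul, mul_zero, zero_add, hf.map_zero, div_mul_cancel₀ x hy0.ne'] at h
  exact h.trans (mul_le_of_le_one_left (hf.nonneg y hy) hle)

/-- The perspective `(s, w) ↦ w * f (s / w)` of a convex function is subadditive. -/
theorem ConvexOn.perspective_add_le_s4 {f : ℝ → ℝ} (hf : ConvexOn ℝ (Set.Icc (0 : ℝ) 1) f)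
    {s₁ w₁ s₂ w₂ : ℝ} (hs₁ : 0 ≤ s₁) (hw₁ : s₁ ≤ w₁) (hs₂ : 0 ≤ s₂) (hw₂ : s₂ ≤ w₂) :
    (w₁ + w₂) * f ((s₁ + s₂) / (w₁ + w₂)) ≤ w₁ * f (s₁ / w₁) + w₂ * f (s₂ / w₂) := by
  rcases (hs₁.trans hw₁).eq_or_lt with h₁ | h₁
  · obtain rfl : s₁ = 0 := le_antisymm (h₁ ▸ hw₁) hs₁
    simp [← h₁]
  rcases (hs₂.trans hw₂).eq_or_lt with h₂ | h₂
  · obtain rfl : s₂ = 0 := le_antisymm (h₂ ▸ hw₂) hs₂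
    simp [← h₂]
  have hw : 0 < w₁ + w₂ := add_pos h₁ h₂
  have hx₁ : s₁ / w₁ ∈ Set.Icc (0 : ℝ) 1 := ⟨div_nonneg hs₁ h₁.le, (div_le_one h₁).2 hw₁⟩
  have hx₂ : s₂ / w₂ ∈ Set.Icc (0 : ℝ) 1 := ⟨div_nonneg hs₂ h₂.le, (div_le_one h₂).2 hw₂⟩
  have hsum : w₁ / (w₁ + w₂) + w₂ / (w₁ + w₂) = 1 := by field_simp
  have h := hf.2 hx₁ hx₂ (div_nonneg h₁.le hw.le) (div_nonneg h₂.le hw.le) hsum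
  simp only [smul_eq_mul] at h
  have he : w₁ / (w₁ + w₂) * (s₁ / w₁) + w₂ / (w₁ + w₂) * (s₂ / w₂) = (s₁ + s₂) / (w₁ + w₂) := by
    field_simp
  rw [he] at h
  calc _ ≤ (w₁ + w₂) * (w₁ / (w₁ + w₂) * f (s₁ / w₁) + w₂ / (w₁ + w₂) * f (s₂ / w₂)) :=
        mul_le_mul_of_nonneg_left h hw.le
    _ = _ := by field_simp

theorem perspective_smul (f : ℝ → ℝ) (t s w : ℝ) :
    (t * w) * f ((t * s) / (t * w)) = t * (w * f (s / w)) := by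
  rcases eq_or_ne t 0 with rfl | ht
  · simp
  · rw [mul_div_mul_left s w ht, mul_assoc]

/-- A Bayesian belief update with likelihoods `a` and `c` preserves `ConvexMinAtZero`. -/
theorem ConvexMinAtZero.bayes {f : ℝ → ℝ} (hf : ConvexMinAtZero f) {g a c : ℝ}
    (hg0 : 0 ≤ g) (hg1 : g ≤ 1) (ha : 0 ≤ a) (hc : 0 ≤ c) :
    ConvexMinAtZero fun p =>
      (p * g * a + (1 - p * g) * c) * f ((p * g * a) / (p * g * a + (1 - p * g) * c)) := by
  have hs : ∀ p ∈ Set.Icc (0 : ℝ) 1, 0 ≤ p * g * a := fun p hp =>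
    mul_nonneg (mul_nonneg hp.1 hg0) ha
  have hw : ∀ p ∈ Set.Icc (0 : ℝ) 1, p * g * a ≤ p * g * a + (1 - p * g) * c := fun p hp =>
    le_add_of_nonneg_right (mul_nonneg (sub_nonneg.2 (mul_le_one₀ hp.2 hg0 hg1)) hc)
  refine ⟨⟨convex_Icc 0 1, ?_⟩, by simp [hf.map_zero], fun p hp => ?_⟩
  · intro x hx y hy u v hu hv huv
    have h := hf.convexOn.perspective_add_le_s4
      (mul_nonneg hu (hs x hx)) (mul_le_mul_of_nonneg_left (hw x hx) hu)
      (mul_nonneg hv (hs y hy)) (mul_le_mul_of_nonneg_left (hw y hy) hv)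
    rw [perspective_smul, perspective_smul] at h
    have hs_eq : u * (x * g * a) + v * (y * g * a) = (u * x + v * y) * g * a := by ring
    have hw_eq : u * (x * g * a + (1 - x * g) * c) + v * (y * g * a + (1 - y * g) * c) =
        (u * x + v * y) * g * a + (1 - (u * x + v * y) * g) * c := by
      linear_combination c * huv
    rw [hs_eq, hw_eq] at h
    simpa only [smul_eq_mul] using h
  · have hw0 := (hs p hp).trans (hw p hp)
    exact mul_nonneg hw0
      (hf.nonneg _ ⟨div_nonneg (hs p hp) hw0, div_le_one_of_le₀ (hw p hp) hw0⟩)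

theorem ConvexMinAtZero.zero : ConvexMinAtZero fun _ => 0 :=
  ⟨convexOn_const 0 (convex_Icc 0 1), rfl, fun _ _ => le_rfl⟩

theorem ConvexMinAtZero.add {f g : ℝ → ℝ} (hf : ConvexMinAtZero f) (hg : ConvexMinAtZero g) :
    ConvexMinAtZero fun p => f p + g p :=
  ⟨hf.convexOn.add hg.convexOn, by simp [hf.map_zero, hg.map_zero],
    fun p hp => add_nonneg (hf.nonneg p hp) (hg.nonneg p hp)⟩

theorem ConvexMinAtZero.sum {ι : Type*} (s : Finset ι) {f : ι → ℝ → ℝ}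
    (hf : ∀ i, ConvexMinAtZero (f i)) : ConvexMinAtZero fun p => ∑ i ∈ s, f i p := by
  classical
  induction s using Finset.induction_on with
  | empty => simpa using ConvexMinAtZero.zero
  | insert i s hi ih =>
    simp only [Finset.sum_insert hi]
    exact (hf i).add ih

theorem ConvexMinAtZero.max {f h : ℝ → ℝ} (hf : ConvexMinAtZero f)
    (hh : ConvexOn ℝ (Set.Icc (0 : ℝ) 1) h) (h0 : h 0 ≤ 0) :
    ConvexMinAtZero fun p => Max.max (f p) (h p) :=
  ⟨hf.convexOn.sup hh, by simp [hf.map_zero, h0],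
    fun p hp => (hf.nonneg p hp).trans (le_max_left _ _)⟩

theorem transmission_utility_convex_strictMono
    (L : ℕ) (hL : 2 ≤ L) (k : Fin L) (τs : ℕ) (hτs : 1 ≤ τs) (T : ℕ)
    (H C : Fin L → Fin L → ℝ)
    (hH : ∀ i j, 0 ≤ H i j) (hC : ∀ i j, 0 ≤ C i j)
    (gE gA : ℕ → ℝ)
    (hgE : ∀ τ, 0 < gE τ ∧ gE τ ≤ 1) (hgA : ∀ τ, 0 < gA τ ∧ gA τ ≤ 1)
    (D : ℝ) (hD : 0 < D) (Y : Fin L → ℝ) (hY : ∀ j, 0 < Y j)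
    (q : ℝ) (hq : q ∈ Set.Icc (0 : ℝ) 1)
    (V E A : ℕ → ℝ → ℝ)
    (hE : ∀ τ p, E τ p =
      ∑ j : Fin L, (p * gE τ * H j k + (1 - p * gE τ) * ∑ i : Fin L, C k i * H i j) *
        V (τ + 1)
          ((p * gE τ * H j k) /
            (p * gE τ * H j k + (1 - p * gE τ) * ∑ i : Fin L, C k i * H i j)))
    (hA : ∀ τ p, A τ p =
      (p * gA τ + (1 - p * gA τ) * q) *
        V (τ + τs) ((p * gA τ) / (p * gA τ + (1 - p * gA τ) * q)) +
      (τs : ℝ) * (p * gA τ * D - (1 - p * gA τ) * ∑ j : Fin L, C k j * Y j))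
    (hV0 : ∀ τ, T < τ → ∀ p : ℝ, V τ p = 0)
    (hVrec : ∀ τ, τ ≤ T → ∀ p : ℝ, V τ p = max (E τ p) (A τ p))
    (hHrow : ∀ i, ∑ j : Fin L, H i j = 1) (hHcol : ∀ j, ∑ i : Fin L, H i j = 1)
    (hCrow : ∑ j : Fin L, C k j = 1) (hCkk : C k k = 0)
    (hMis1 : ∀ j, j ≠ k → H j k < ∑ i : Fin L, C k i * H i j)
    (hMis2 : ∀ j, j ≠ k → H j k * (∑ i : Fin L, C k i * H i k)
      < H k k * (∑ i : Fin L, C k i * H i j)) :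
    ∀ τ, τ ≤ T →
      ConvexOn ℝ (Set.Icc (0 : ℝ) 1) (A τ) ∧ StrictMonoOn (A τ) (Set.Icc (0 : ℝ) 1) := by
  have hc : ∀ j, 0 ≤ ∑ i : Fin L, C k i * H i j := fun j =>
    sum_nonneg fun i _ => mul_nonneg (hC k i) (hH i j)
  have hS : 0 ≤ ∑ j : Fin L, C k j * Y j :=
    sum_nonneg fun j _ => mul_nonneg (hC k j) (hY j).le
  have hτs0 : (0 : ℝ) < τs := by exact_mod_cast hτs
  have hslope : ∀ τ, 0 < (τs : ℝ) * (gA τ * (D + ∑ j : Fin L, C k j * Y j)) := fun τ =>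
    mul_pos hτs0 (mul_pos (hgA τ).1 (add_pos_of_pos_of_nonneg hD hS))
  have hA_eq : ∀ τ, A τ = fun p =>
      (p * gA τ * 1 + (1 - p * gA τ) * q) *
        V (τ + τs) ((p * gA τ * 1) / (p * gA τ * 1 + (1 - p * gA τ) * q)) +
      ((τs : ℝ) * (gA τ * (D + ∑ j : Fin L, C k j * Y j)) * p -
        τs * ∑ j : Fin L, C k j * Y j) := by
    intro τ
    funext p
    rw [hA, mul_one]
    ring
  have hA_conv : ∀ τ, ConvexMinAtZero (V (τ + τs)) →
      ConvexOn ℝ (Set.Icc (0 : ℝ) 1) (A τ) := by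
    intro τ hV
    rw [hA_eq]
    refine (hV.bayes (hgA τ).1.le (hgA τ).2 zero_le_one hq.1).convexOn.add ⟨convex_Icc 0 1, ?_⟩
    intro x _ y _ u v _ _ huv
    simp only [smul_eq_mul]
    refine le_of_eq ?_
    linear_combination (τs * ∑ j : Fin L, C k j * Y j) * huv
  have hV : ∀ n τ, T < τ + n → ConvexMinAtZero (V τ) := by
    intro n
    induction n with
    | zero =>
      intro τ hτ
      rw [show V τ = fun _ => 0 from funext (hV0 τ hτ)]
      exact ConvexMinAtZero.zero
    | succ n ih =>
      intro τ hτ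
      rcases lt_or_ge T τ with hlt | hle
      · rw [show V τ = fun _ => 0 from funext (hV0 τ hlt)]
        exact ConvexMinAtZero.zero
      have hEτ : ConvexMinAtZero (E τ) := by
        rw [show E τ = _ from funext (hE τ)]
        exact ConvexMinAtZero.sum _ fun j =>
          (ih (τ + 1) (by omega)).bayes (hgE τ).1.le (hgE τ).2 (hH j k) (hc j)
      have hnext := ih (τ + τs) (by omega)
      rw [show V τ = _ from funext (hVrec τ hle)]
      refine hEτ.max (hA_conv τ hnext) ?_
      rw [hA]
      simpa [hnext.map_zero] using mul_nonneg hτs0.le hS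
  intro τ _
  have hnext := hV (T + 1) (τ + τs) (by omega)
  refine ⟨hA_conv τ hnext, ?_⟩
  rw [hA_eq]
  intro x hx y hy hxy
  exact add_lt_add_of_le_of_lt
    ((hnext.bayes (hgA τ).1.le (hgA τ).2 zero_le_one hq.1).monotoneOn hx hy hxy.le)
    (sub_lt_sub_right (mul_lt_mul_of_pos_left hxy (hslope τ)) _)
end
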